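/- Let R and S be left Noetherian rings. Then qgldim(R × S) = max{qgldim(R), qgldim(S)}, where R × S is the product ring. -/

import Mathlib

/-!
Quasi-projective dimension, following Gheibi–Jorgensen–Takahashi and
Chen–Chen–Liu, "Properties of quasi-projective dimension over abelian categories".
-/

open CategoryTheory CategoryTheory.Limits

attribute [local instance] CategoryTheory.Abelian.hasFiniteBiproducts

noncomputable section

universe v u

namespace QPD

variable {A : Type*} [Category A] [Abelian A]

/-- The direct sum of `n` copies of `M`. -/
def copies (M : A) (n : ℕ) : A := ⨁ (fun _ : Fin n => M)

/-- `X` belongs to `add M`: it is a direct summand of a finite direct sum of copies of `M`. -/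
def inAdd (M X : A) : Prop :=
  ∃ (n : ℕ) (s : X ⟶ copies M n) (r : copies M n ⟶ X), s ≫ r = 𝟙 X

/-- `P` is a quasi-projective resolution of `M`: a bounded-below complex of projective
objects whose `j`-th homology is a direct sum of `mult j` copies of `M`, where the
multiplicities `mult j` are not all zero. -/
structure IsQuasiProjRes (M : A) (P : ChainComplex A ℤ) : Prop where
  projective : ∀ i, Projective (P.X i)
  bddBelow : ∃ a : ℤ, ∀ i, i < a → IsZero (P.X i)
  homology_iso : ∃ mult : ℤ → ℕ, (∃ j, mult j ≠ 0) ∧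
    ∀ j, Nonempty (P.homology j ≅ copies M (mult j))

/-- `P` is a finite (i.e. bounded) quasi-projective resolution of `M`. -/
structure IsFiniteQuasiProjRes (M : A) (P : ChainComplex A ℤ) extends
    IsQuasiProjRes M P : Prop where
  bddAbove : ∃ b : ℤ, ∀ i, b < i → IsZero (P.X i)

/-- `s` is the supremum of the degrees in which `P` is nonzero. -/
def IsSup (P : ChainComplex A ℤ) (s : ℤ) : Prop :=
  ¬ IsZero (P.X s) ∧ ∀ i, s < i → IsZero (P.X i)

/-- `t` is the supremum of the degrees in which the homology of `P` is nonzero. -/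
def IsHSup (P : ChainComplex A ℤ) (t : ℤ) : Prop :=
  ¬ IsZero (P.homology t) ∧ ∀ i, t < i → IsZero (P.homology i)

/-- `t` is the infimum of the degrees in which the homology of `P` is nonzero. -/
def IsHInf (P : ChainComplex A ℤ) (t : ℤ) : Prop :=
  ¬ IsZero (P.homology t) ∧ ∀ i, i < t → IsZero (P.homology i)

open Classical in
/-- The quasi-projective dimension of `M`, as an element of `ℕ∞`: the infimum of
`sup P• - hsup P•` over all finite quasi-projective resolutions `P•` of `M`
(it is `0` for the zero object and `⊤` if no finite quasi-projective resolution exists). -/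
def qpd (M : A) : ℕ∞ :=
  if IsZero M then 0
  else sInf {d : ℕ∞ | ∃ (P : ChainComplex A ℤ) (s t : ℤ),
    IsFiniteQuasiProjRes M P ∧ IsSup P s ∧ IsHSup P t ∧ d = ((s - t).toNat : ℕ∞)}

/-- `M` admits a projective resolution of length at most `n`. -/
def pdLE (M : A) (n : ℕ) : Prop :=
  ∃ P : ChainComplex A ℤ, (∀ i, Projective (P.X i)) ∧
    (∀ i : ℤ, i < 0 → IsZero (P.X i)) ∧ (∀ i : ℤ, (n : ℤ) < i → IsZero (P.X i)) ∧
    (∀ i : ℤ, i ≠ 0 → IsZero (P.homology i)) ∧ Nonempty (P.homology 0 ≅ M)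

/-- The projective dimension of `M`, as an element of `ℕ∞`. -/
def pd (M : A) : ℕ∞ := sInf {d : ℕ∞ | ∃ n : ℕ, d = (n : ℕ∞) ∧ pdLE M n}

open Classical in
/-- Quasi-projective dimension computed using only complexes all of whose terms satisfy the
predicate `Q` (e.g. `Q` = "finitely generated", for the category of finitely presented
modules over a left coherent ring). -/
def qpdRel (Q : A → Prop) (M : A) : ℕ∞ :=
  if IsZero M then 0
  else sInf {d : ℕ∞ | ∃ (P : ChainComplex A ℤ) (s t : ℤ),
    IsFiniteQuasiProjRes M P ∧ (∀ i, Q (P.X i)) ∧ IsSup P s ∧ IsHSup P t ∧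
    d = ((s - t).toNat : ℕ∞)}

/-- Projective dimension computed using only resolutions all of whose terms satisfy the
predicate `Q`. -/
def pdRel (Q : A → Prop) (M : A) : ℕ∞ :=
  sInf {d : ℕ∞ | ∃ n : ℕ, d = (n : ℕ∞) ∧ ∃ P : ChainComplex A ℤ,
    (∀ i, Projective (P.X i)) ∧ (∀ i, Q (P.X i)) ∧
    (∀ i : ℤ, i < 0 → IsZero (P.X i)) ∧ (∀ i : ℤ, (n : ℤ) < i → IsZero (P.X i)) ∧
    (∀ i : ℤ, i ≠ 0 → IsZero (P.homology i)) ∧ Nonempty (P.homology 0 ≅ M)}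

/-- Vanishing of the `n`-th Ext group, `Ext_𝒜^n(M, N) = 0`. -/
def extIsZero [EnoughProjectives A] (M N : A) (n : ℕ) : Prop :=
  IsZero (((_root_.Ext ℤ A n).obj (Opposite.op M)).obj N)

/-- The quasi-projective dimension of a finitely presented module over a (left coherent)
ring, computed inside the abelian category of finitely presented modules, i.e. via bounded
complexes of finitely generated projective modules. -/
def qpdFG {R : Type u} [Ring R] (M : ModuleCat.{u} R) : ℕ∞ :=
  qpdRel (fun N : ModuleCat.{u} R => Module.Finite R N) M

/-- The projective dimension of a finitely presented module over a (left coherent) ring,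
computed inside the abelian category of finitely presented modules. -/
def pdFG {R : Type u} [Ring R] (M : ModuleCat.{u} R) : ℕ∞ :=
  pdRel (fun N : ModuleCat.{u} R => Module.Finite R N) M

/-- A ring is left coherent if every finitely generated left ideal is finitely presented. -/
def IsLeftCoherent (R : Type u) [Ring R] : Prop :=
  ∀ I : Ideal R, I.FG → Module.FinitePresentation R I

/-- The quasi-global dimension of a ring: the supremum of the quasi-projective dimensions
of all finitely generated left modules. -/
def qgldim (R : Type u) [Ring R] : ℕ∞ :=
  sSup {d : ℕ∞ | ∃ M : ModuleCat.{u} R, Module.Finite R M ∧ d = qpd M}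

/-- The global dimension of a ring: the supremum of the projective dimensions of all
finitely generated left modules. -/
def gldim (R : Type u) [Ring R] : ℕ∞ :=
  sSup {d : ℕ∞ | ∃ M : ModuleCat.{u} R, Module.Finite R M ∧ d = pd M}

/-- The finitistic dimension of a ring: the supremum of the projective dimensions of all
finitely generated left modules of finite projective dimension. -/
def findim (R : Type u) [Ring R] : ℕ∞ :=
  sSup {d : ℕ∞ | ∃ M : ModuleCat.{u} R, Module.Finite R M ∧ d = pd M ∧ pd M ≠ ⊤}

/-- The depth of a module over a Noetherian local ring:
`depth M = inf {i : Ext^i(R/𝔪, M) ≠ 0}`. -/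
def depth {R : Type u} [CommRing R] [IsLocalRing R] (M : ModuleCat.{u} R) : ℕ∞ :=
  sInf {d : ℕ∞ | ∃ n : ℕ, d = (n : ℕ∞) ∧
    ¬ IsZero (((_root_.Ext ℤ (ModuleCat.{u} R) n).obj
      (Opposite.op (ModuleCat.of R (IsLocalRing.ResidueField R)))).obj M)}

end QPD

end

namespace QPD

open Polynomial ZeroObject

section Abelian

variable {A : Type*} [Category A] [Abelian A]

lemma isZero_copies_zero (M : A) : IsZero (copies M 0) := by
  rw [IsZero.iff_id_eq_zero]
  exact biproduct.hom_ext _ _ fun j => j.elim0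

lemma isZero_copies_of_isZero {M : A} (hM : IsZero M) (n : ℕ) : IsZero (copies M n) := by
  rw [IsZero.iff_id_eq_zero]
  exact biproduct.hom_ext _ _ fun _ => hM.eq_of_tgt _ _

lemma not_isZero_copies {M : A} (hM : ¬ IsZero M) {n : ℕ} (hn : n ≠ 0) :
    ¬ IsZero (copies M n) := fun h =>
  hM (h.of_mono (biproduct.ι (fun _ : Fin n => M) ⟨0, Nat.pos_of_ne_zero hn⟩))

/-- A sum of `m + n` copies splits as a sum of `m` copies and a sum of `n` copies. -/
noncomputable def copiesAddIso (M : A) (m n : ℕ) :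
    (⨁ fun _ : Fin (m + n) => M) ≅ (⨁ fun _ : Fin m => M) ⊞ (⨁ fun _ : Fin n => M) where
  hom := biprod.lift
    (biproduct.lift fun i => biproduct.π (fun _ : Fin (m + n) => M) (i.castAdd n))
    (biproduct.lift fun i => biproduct.π (fun _ : Fin (m + n) => M) (i.natAdd m))
  inv := biproduct.lift fun i => i.addCases
    (fun i => biprod.fst ≫ biproduct.π (fun _ : Fin m => M) i)
    (fun i => biprod.snd ≫ biproduct.π (fun _ : Fin n => M) i)
  hom_inv_id := by
    refine biproduct.hom_ext _ _ fun i => ?_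
    refine i.addCases (fun i => ?_) (fun i => ?_) <;> simp
  inv_hom_id := by
    refine biprod.hom_ext _ _ ?_ ?_ <;>
    · refine biproduct.hom_ext _ _ fun i => ?_
      simp

/-- Copies of a binary direct sum. -/
noncomputable def copiesBiprodIso (M N : A) (n : ℕ) :
    (⨁ fun _ : Fin n => M ⊞ N) ≅ (⨁ fun _ : Fin n => M) ⊞ (⨁ fun _ : Fin n => N) where
  hom := biprod.lift (biproduct.map fun _ => biprod.fst) (biproduct.map fun _ => biprod.snd)
  inv := biproduct.lift fun i => biprod.lift
    (biprod.fst ≫ biproduct.π (fun _ : Fin n => M) i)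
    (biprod.snd ≫ biproduct.π (fun _ : Fin n => N) i)
  hom_inv_id := by
    refine biproduct.hom_ext _ _ fun i => biprod.hom_ext _ _ ?_ ?_ <;> simp
  inv_hom_id := by
    refine biprod.hom_ext _ _ ?_ ?_ <;>
    · refine biproduct.hom_ext _ _ fun i => ?_
      simp

/-- The chain complex `P` reindexed by `i ↦ i + t`. -/
@[simps]
def reindex (P : ChainComplex A ℤ) (t : ℤ) : ChainComplex A ℤ where
  X i := P.X (i + t)
  d i j := P.d (i + t) (j + t)
  shape i j h := P.shape _ _ fun h' => h (by simp at h' ⊢; omega)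

/-- The homology of a reindexed complex. -/
noncomputable def reindexHomologyIso (P : ChainComplex A ℤ) (t j : ℤ) :
    (reindex P t).homology j ≅ P.homology (j + t) :=
  ShortComplex.homologyMapIso ((reindex P t).isoSc' (j + 1) j (j - 1) (by simp) (by simp)) ≪≫
    ShortComplex.homologyMapIso
      (P.isoSc' (j + 1 + t) (j + t) (j - 1 + t) (by simp; ring) (by simp; ring)).symm

lemma isZero_homology {P : ChainComplex A ℤ} {i : ℤ} (h : IsZero (P.X i)) :
    IsZero (P.homology i) :=
  ShortComplex.isZero_homology_of_isZero_X₂ _ h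

/-- There is a bounded complex of projectives, zero in degrees `> n`, whose homology in degree
`-k` is a sum of `p.coeff k` copies of `M` and whose homology in positive degrees vanishes. -/
def HasResWithMult (M : A) (n : ℤ) (p : ℕ[X]) : Prop :=
  ∃ P : ChainComplex A ℤ, (∀ i, Projective (P.X i)) ∧
    (∃ a : ℤ, ∀ i, i < a → IsZero (P.X i)) ∧ (∀ i, n < i → IsZero (P.X i)) ∧
    (∀ k : ℕ, Nonempty (P.homology (-k) ≅ copies M (p.coeff k))) ∧
    ∀ i, 0 < i → IsZero (P.homology i)

namespace HasResWithMult

variable {M N : A} {n : ℤ} {p q : ℕ[X]}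

lemma of_iso (h : HasResWithMult M n p) (e : M ≅ N) : HasResWithMult N n p := by
  obtain ⟨P, h₁, h₂, h₃, h₄, h₅⟩ := h
  exact ⟨P, h₁, h₂, h₃, fun k => (h₄ k).map (· ≪≫ biproduct.mapIso fun _ => e), h₅⟩

lemma of_forall_isZero (n : ℤ) (h : ∀ k, IsZero (copies M (p.coeff k))) :
    HasResWithMult M n p := by
  have hX (i : ℤ) : IsZero ((0 : ChainComplex A ℤ).X i) :=
    (HomologicalComplex.eval A _ i).map_isZero (isZero_zero _)
  exact ⟨0, fun i => (hX i).projective, ⟨0, fun i _ => hX i⟩, fun i _ => hX i,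
    fun k => ⟨(isZero_homology (hX _)).iso (h k)⟩, fun i _ => isZero_homology (hX i)⟩

lemma map {B : Type*} [Category B] [Abelian B] (F : A ⥤ B) [F.Additive] [F.PreservesHomology]
    [F.PreservesProjectiveObjects] (h : HasResWithMult M n p) :
    HasResWithMult (F.obj M) n p := by
  obtain ⟨P, h₁, ⟨a, h₂⟩, h₃, h₄, h₅⟩ := h
  let e (i : ℤ) : ((F.mapHomologicalComplex _).obj P).homology i ≅ F.obj (P.homology i) :=
    (P.sc i).mapHomologyIso F
  refine ⟨(F.mapHomologicalComplex _).obj P, fun i => F.projective_obj_of_projective (h₁ i),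
    ⟨a, fun i hi => F.map_isZero (h₂ i hi)⟩, fun i hi => F.map_isZero (h₃ i hi),
    fun k => (h₄ k).map fun f => e _ ≪≫ F.mapIso f ≪≫ F.mapBiproduct _,
    fun i hi => (F.map_isZero (h₅ i hi)).of_iso (e i)⟩

lemma exists_biprod {n : ℤ} {P Q : ChainComplex A ℤ} {T : ℕ → A}
    (hP : (∀ i, Projective (P.X i)) ∧
      (∃ a : ℤ, ∀ i, i < a → IsZero (P.X i)) ∧ (∀ i, n < i → IsZero (P.X i)) ∧
      ∀ i, 0 < i → IsZero (P.homology i))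
    (hQ : (∀ i, Projective (Q.X i)) ∧
      (∃ a : ℤ, ∀ i, i < a → IsZero (Q.X i)) ∧ (∀ i, n < i → IsZero (Q.X i)) ∧
      ∀ i, 0 < i → IsZero (Q.homology i))
    (hT : ∀ k : ℕ, Nonempty (P.homology (-k) ⊞ Q.homology (-k) ≅ T k)) :
    ∃ P : ChainComplex A ℤ, (∀ i, Projective (P.X i)) ∧
      (∃ a : ℤ, ∀ i, i < a → IsZero (P.X i)) ∧ (∀ i, n < i → IsZero (P.X i)) ∧
      (∀ k : ℕ, Nonempty (P.homology (-k) ≅ T k)) ∧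
      ∀ i, 0 < i → IsZero (P.homology i) := by
  obtain ⟨hP₁, ⟨a, hP₂⟩, hP₃, hP₄⟩ := hP
  obtain ⟨hQ₁, ⟨b, hQ₂⟩, hQ₃, hQ₄⟩ := hQ
  let eX (i : ℤ) : (P ⊞ Q).X i ≅ P.X i ⊞ Q.X i :=
    (HomologicalComplex.eval A _ i).mapBiprod P Q
  have hH' (i : ℤ) :=
    preservesBinaryBiproducts_of_preservesBiproducts
      (HomologicalComplex.homologyFunctor A (ComplexShape.down ℤ) i)
  let eH (i : ℤ) : (P ⊞ Q).homology i ≅ P.homology i ⊞ Q.homology i :=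
    (HomologicalComplex.homologyFunctor A _ i).mapBiprod P Q
  have hz {X Y : A} (hX : IsZero X) (hY : IsZero Y) : IsZero (X ⊞ Y) :=
    (biprod_isZero_iff X Y).2 ⟨hX, hY⟩
  exact ⟨P ⊞ Q, fun i => Projective.of_iso (eX i).symm inferInstance,
    ⟨min a b, fun i hi => (hz (hP₂ i (by omega)) (hQ₂ i (by omega))).of_iso (eX i)⟩,
    fun i hi => (hz (hP₃ i hi) (hQ₃ i hi)).of_iso (eX i),
    fun k => (hT k).map fun f => eH _ ≪≫ f,
    fun i hi => (hz (hP₄ i hi) (hQ₄ i hi)).of_iso (eH i)⟩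

lemma add (hp : HasResWithMult M n p) (hq : HasResWithMult M n q) :
    HasResWithMult M n (p + q) := by
  obtain ⟨P, h₁, h₂, h₃, h₄, h₅⟩ := hp
  obtain ⟨Q, g₁, g₂, g₃, g₄, g₅⟩ := hq
  refine exists_biprod ⟨h₁, h₂, h₃, h₅⟩ ⟨g₁, g₂, g₃, g₅⟩ fun k => ?_
  obtain ⟨f⟩ := h₄ k
  obtain ⟨g⟩ := g₄ k
  rw [coeff_add]
  exact ⟨biprod.mapIso f g ≪≫ (copiesAddIso M _ _).symm⟩

lemma biprod (hM : HasResWithMult M n p) (hN : HasResWithMult N n p) :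
    HasResWithMult (M ⊞ N) n p := by
  obtain ⟨P, h₁, h₂, h₃, h₄, h₅⟩ := hM
  obtain ⟨Q, g₁, g₂, g₃, g₄, g₅⟩ := hN
  refine exists_biprod ⟨h₁, h₂, h₃, h₅⟩ ⟨g₁, g₂, g₃, g₅⟩ fun k => ?_
  obtain ⟨f⟩ := h₄ k
  obtain ⟨g⟩ := g₄ k
  exact ⟨biprod.mapIso f g ≪≫ (copiesBiprodIso M N _).symm⟩

lemma X_mul (hp : HasResWithMult M n p) : HasResWithMult M n (X * p) := by
  obtain ⟨P, h₁, ⟨a, h₂⟩, h₃, h₄, h₅⟩ := hp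
  refine ⟨reindex P 1, fun i => h₁ _, ⟨a - 1, fun i hi => h₂ _ (by omega)⟩,
    fun i hi => h₃ _ (by omega), fun k => ?_,
    fun i hi => (h₅ (i + 1) (by omega)).of_iso (reindexHomologyIso P 1 i)⟩
  cases k with
  | zero =>
    rw [coeff_X_mul_zero]
    exact ⟨((h₅ (-(0 : ℕ) + 1) (by simp)).of_iso (reindexHomologyIso P 1 _)).iso
      (isZero_copies_zero M)⟩
  | succ k =>
    rw [coeff_X_mul]
    obtain ⟨f⟩ := h₄ k
    exact ⟨reindexHomologyIso P 1 _ ≪≫ eqToIso (by congr 1; push_cast; ring) ≪≫ f⟩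

lemma C_mul (hp : HasResWithMult M n p) (a : ℕ) : HasResWithMult M n (C a * p) := by
  induction a with
  | zero => exact of_forall_isZero n fun k => by simpa using isZero_copies_zero M
  | succ a ih =>
    rw [map_add, add_mul, map_one, one_mul]
    exact ih.add hp

lemma mul (hp : HasResWithMult M n p) (q : ℕ[X]) : HasResWithMult M n (q * p) := by
  induction q using Polynomial.induction_on with
  | C a => exact hp.C_mul a
  | add q r hq hr => rw [add_mul]; exact hq.add hr
  | monomial k a h =>
    have : C a * X ^ (k + 1) * p = X * (C a * X ^ k * p) := by ring
    rw [this]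
    exact h.X_mul

end HasResWithMult

lemma qpd_le_iff {M : A} {n : ℕ} :
    qpd M ≤ n ↔ ∃ p : ℕ[X], p.coeff 0 ≠ 0 ∧ HasResWithMult M n p := by
  by_cases hM : IsZero M
  · simp only [qpd, if_pos hM, zero_le, true_iff]
    exact ⟨1, by simp, .of_forall_isZero _ fun k => isZero_copies_of_isZero hM _⟩
  simp only [qpd, if_neg hM]
  constructor
  · intro h
    have hne : {d : ℕ∞ | ∃ (P : ChainComplex A ℤ) (s t : ℤ),
        IsFiniteQuasiProjRes M P ∧ IsSup P s ∧ IsHSup P t ∧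
        d = ((s - t).toNat : ℕ∞)}.Nonempty := by
      by_contra hne
      rw [Set.not_nonempty_iff_eq_empty] at hne
      rw [hne, sInf_empty, top_le_iff] at h
      exact ENat.natCast_ne_top n h
    obtain ⟨P, s, t, hP, hs, ht, hd⟩ := csInf_mem hne
    rw [hd, Nat.cast_le] at h
    obtain ⟨a, ha⟩ := hP.bddBelow
    obtain ⟨mult, -, hm⟩ := hP.homology_iso
    refine ⟨∑ k ∈ Finset.range (t + 1 - a).toNat, monomial k (mult (t - k)), ?_,
      reindex P t, fun i => hP.projective _, ⟨a - t, fun i hi => ha _ (by omega)⟩,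
      fun i hi => hs.2 _ (by omega), fun k => ?_,
      fun i hi => (ht.2 (i + t) (by omega)).of_iso (reindexHomologyIso P t i)⟩
    · have hat : a ≤ t := by
        by_contra hlt
        exact ht.1 (isZero_homology (ha t (by omega)))
      have h0 : mult t ≠ 0 := fun h0 => by
        obtain ⟨f⟩ := hm t
        rw [h0] at f
        exact ht.1 ((isZero_copies_zero M).of_iso f)
      simp only [finsetSum_coeff, coeff_monomial, Finset.sum_ite_eq', Finset.mem_range]
      rw [if_pos (by omega)]
      simpa using h0
    · simp only [finsetSum_coeff, coeff_monomial, Finset.sum_ite_eq', Finset.mem_range]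
      have e : (reindex P t).homology (-k) ≅ P.homology (t - k) :=
        reindexHomologyIso P t _ ≪≫ eqToIso (by congr 1; ring)
      split_ifs with hk
      · exact (hm _).map (e ≪≫ ·)
      · exact ⟨((isZero_homology (ha _ (by omega))).of_iso e).iso (isZero_copies_zero M)⟩
  · rintro ⟨p, hp, P, h₁, h₂, h₃, h₄, h₅⟩
    have hH : ¬ IsZero (P.homology 0) := fun h0 => by
      obtain ⟨f⟩ := h₄ 0
      exact not_isZero_copies hM hp (h0.of_iso f.symm)
    obtain ⟨s, hs, hs'⟩ := Int.exists_greatest_of_bdd (P := fun i => ¬ IsZero (P.X i))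
      ⟨n, fun i hi => by by_contra! hlt; exact hi (h₃ i hlt)⟩
      ⟨0, fun h0 => hH (isZero_homology h0)⟩
    have hsn : s ≤ n := by by_contra! hlt; exact hs (h₃ s hlt)
    refine le_trans (sInf_le (a := ((s - 0).toNat : ℕ∞)) ⟨P, s, 0, ⟨⟨h₁, h₂, fun j => if j ≤ 0 then p.coeff (-j).toNat else 0,
      ⟨0, by simpa using hp⟩, fun j => ?_⟩, n, h₃⟩,
      ⟨hs, fun i hi => by by_contra hi'; have := hs' i hi'; omega⟩, ⟨hH, h₅⟩, rfl⟩)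
      (Nat.cast_le.2 (by omega))
    dsimp only
    split_ifs with hj
    · obtain ⟨k, rfl⟩ : ∃ k : ℕ, j = -k := ⟨(-j).toNat, by omega⟩
      simpa using h₄ k
    · exact ⟨(h₅ j (by omega)).iso (isZero_copies_zero M)⟩

lemma forall_natCast_le_imp_le {a b : ℕ∞} (h : ∀ n : ℕ, b ≤ n → a ≤ n) : a ≤ b := by
  induction b with
  | top => exact le_top
  | coe b => exact h b le_rfl

lemma qpd_map_le {B : Type*} [Category B] [Abelian B] (F : A ⥤ B) [F.Additive]
    [F.PreservesHomology] [F.PreservesProjectiveObjects] (M : A) :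
    qpd (F.obj M) ≤ qpd M := by
  refine forall_natCast_le_imp_le fun n hn => ?_
  obtain ⟨p, hp, h⟩ := qpd_le_iff.1 hn
  exact qpd_le_iff.2 ⟨p, hp, h.map F⟩

lemma qpd_le_of_iso {M N : A} (e : M ≅ N) : qpd N ≤ qpd M := by
  refine forall_natCast_le_imp_le fun n hn => ?_
  obtain ⟨p, hp, h⟩ := qpd_le_iff.1 hn
  exact qpd_le_iff.2 ⟨p, hp, h.of_iso e⟩

lemma qpd_biprod_le (M N : A) : qpd (M ⊞ N) ≤ max (qpd M) (qpd N) := by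
  refine forall_natCast_le_imp_le fun n hn => ?_
  rw [max_le_iff] at hn
  obtain ⟨p, hp, hM⟩ := qpd_le_iff.1 hn.1
  obtain ⟨q, hq, hN⟩ := qpd_le_iff.1 hn.2
  refine qpd_le_iff.2 ⟨q * p, ?_, (hM.mul q).biprod (mul_comm p q ▸ hN.mul p)⟩
  rw [mul_coeff_zero]
  exact mul_ne_zero hq hp

end Abelian

/-- `φ : T → R` exhibits `R` as a direct factor of the ring `T`, the (non-unital) inclusion
of the factor being `ψ`. -/
structure IsRingFactor {T R : Type u} [Ring T] [Ring R] (φ : T →+* R) (ψ : R →ₙ+* T) : Prop where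
  map_map : ∀ r, φ (ψ r) = r
  mul_map_one : ∀ t, t * ψ 1 = ψ (φ t)
  map_one_mul : ∀ t, ψ 1 * t = ψ (φ t)

namespace IsRingFactor

variable {T R : Type u} [Ring T] [Ring R] {φ : T →+* R} {ψ : R →ₙ+* T}

/-- The part of a `T`-module supported on the factor `R`. -/
def corner (h : IsRingFactor φ ψ) (M : Type u) [AddCommGroup M] [Module T M] :
    Submodule T M where
  carrier := {m | ψ 1 • m = m}
  add_mem' {a b} ha hb := by
    change ψ 1 • (a + b) = a + b
    rw [smul_add, show ψ 1 • a = a from ha, show ψ 1 • b = b from hb]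
  zero_mem' := smul_zero _
  smul_mem' t m hm := by
    change ψ 1 • t • m = t • m
    rw [← mul_smul, h.map_one_mul, ← h.mul_map_one, mul_smul, show ψ 1 • m = m from hm]

lemma map_one_smul_mem (h : IsRingFactor φ ψ) {M : Type u} [AddCommGroup M] [Module T M]
    (m : M) : ψ 1 • m ∈ h.corner M := by
  change ψ 1 • ψ 1 • m = ψ 1 • m
  rw [← mul_smul, ← map_mul, one_mul]

/-- The part of a `T`-module supported on the factor `R`, as an `R`-module. -/
def cornerObj (h : IsRingFactor φ ψ) (M : ModuleCat.{u} T) : ModuleCat.{u} R :=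
  letI : Module R (h.corner M) :=
    { smul := fun r m => ψ r • m
      one_smul := fun m => Subtype.ext m.2
      mul_smul := fun r s m => by
        change ψ (r * s) • m = ψ r • ψ s • m
        rw [map_mul, mul_smul]
      smul_zero := fun r => smul_zero (ψ r)
      smul_add := fun r => smul_add (ψ r)
      add_smul := fun r s m => by
        change ψ (r + s) • m = ψ r • m + ψ s • m
        rw [map_add, add_smul]
      zero_smul := fun m => by
        change ψ 0 • m = 0
        rw [map_zero, zero_smul] }
  ModuleCat.of R (h.corner M)

lemma smul_coe (h : IsRingFactor φ ψ) {M : ModuleCat.{u} T} (t : T) (m : h.corner M) :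
    t • m.1 = ψ (φ t) • m.1 := by
  conv_lhs => rw [← (show ψ 1 • m.1 = m.1 from m.2), ← mul_smul, h.mul_map_one]

/-- Taking the part of a `T`-module supported on the factor `R`, as a functor. -/
def cornerFunctor (h : IsRingFactor φ ψ) : ModuleCat.{u} T ⥤ ModuleCat.{u} R where
  obj M := h.cornerObj M
  map {M N} f := ModuleCat.ofHom (X := h.cornerObj M) (Y := h.cornerObj N)
    { toFun := fun m => (⟨f (m : h.corner M).1, by
        change ψ 1 • f _ = f _
        rw [← map_smul, (show ψ 1 • (m : h.corner M).1 = _ from (m : h.corner M).2)]⟩ :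
          h.corner N)
      map_add' := fun x y => Subtype.ext (map_add f.hom _ _)
      map_smul' := fun r x => Subtype.ext (map_smul f.hom (ψ r) _) }

instance (h : IsRingFactor φ ψ) : h.cornerFunctor.Additive where

/-- Restriction of scalars along the projection onto a factor is left adjoint to taking the
part supported on that factor. -/
noncomputable def restrictAdj (h : IsRingFactor φ ψ) : ModuleCat.restrictScalars.{u} φ ⊣ h.cornerFunctor :=
  Adjunction.mkOfUnitCounit
    { unit :=
        { app := fun N => ModuleCat.ofHom (Y := h.cornerObj _)
            { toFun := fun n => (⟨n, by
                change φ (ψ 1) • (show N from n) = n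
                rw [h.map_map, one_smul]⟩ : h.corner ((ModuleCat.restrictScalars φ).obj N))
              map_add' := fun x y => rfl
              map_smul' := fun r x => Subtype.ext (by
                change r • x = φ (ψ r) • x
                rw [h.map_map]) } }
      counit :=
        { app := fun M => ModuleCat.ofHom (X := (ModuleCat.restrictScalars φ).obj (h.cornerObj M))
            { toFun := fun m => (m : h.corner M).1
              map_add' := fun x y => rfl
              map_smul' := fun t x => (h.smul_coe t x).symm } } }

/-- Restriction of scalars along the projection onto a factor is right adjoint to taking the
part supported on that factor. -/
noncomputable def cornerAdj (h : IsRingFactor φ ψ) : h.cornerFunctor ⊣ ModuleCat.restrictScalars.{u} φ :=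
  Adjunction.mkOfUnitCounit
    { unit :=
        { app := fun M => ModuleCat.ofHom (Y := (ModuleCat.restrictScalars φ).obj (h.cornerObj M))
            { toFun := fun m => (⟨ψ 1 • m, h.map_one_smul_mem m⟩ : h.corner M)
              map_add' := fun x y => Subtype.ext (smul_add _ _ _)
              map_smul' := fun t x => Subtype.ext (by
                change ψ 1 • t • x = ψ (φ t) • ψ 1 • x
                rw [← mul_smul, ← mul_smul, ← map_mul, mul_one, h.map_one_mul]) }
          naturality := fun M N f => by
            ext m
            exact Subtype.ext (map_smul f.hom _ _).symm }
      counit :=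
        { app := fun N => ModuleCat.ofHom (X := h.cornerObj _)
            { toFun := fun n => (n : h.corner ((ModuleCat.restrictScalars φ).obj N)).1
              map_add' := fun x y => rfl
              map_smul' := fun r x => by
                change φ (ψ r) • (show N from (x : h.corner _).1) =
                  r • (show N from (x : h.corner _).1)
                rw [h.map_map] } }
      left_triangle := by
        ext M m
        exact Subtype.ext (m : h.corner M).2
      right_triangle := by
        ext N n
        change φ (ψ 1) • (show N from n) = n
        rw [h.map_map, one_smul] }

instance (h : IsRingFactor φ ψ) : h.cornerFunctor.PreservesHomology := by
  have := h.restrictAdj.rightAdjoint_preservesLimits.{0, 0}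
  have := h.cornerAdj.leftAdjoint_preservesColimits.{0, 0}
  infer_instance

lemma restrictScalars_preservesHomology (h : IsRingFactor φ ψ) :
    (ModuleCat.restrictScalars.{u} φ).PreservesHomology := by
  have := h.cornerAdj.rightAdjoint_preservesLimits.{0, 0}
  have := h.restrictAdj.leftAdjoint_preservesColimits.{0, 0}
  infer_instance

instance (h : IsRingFactor φ ψ) : h.cornerFunctor.PreservesProjectiveObjects where
  projective_obj hP := by
    have := h.restrictAdj.isLeftAdjoint
    exact h.cornerAdj.map_projective _ hP

lemma restrictScalars_preservesProjectiveObjects (h : IsRingFactor φ ψ) :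
    (ModuleCat.restrictScalars.{u} φ).PreservesProjectiveObjects where
  projective_obj hP := by
    have := h.cornerAdj.isLeftAdjoint
    exact h.restrictAdj.map_projective _ hP

/-- The part of the restriction of an `R`-module supported on `R` is everything. -/
noncomputable def cornerRestrictIso (h : IsRingFactor φ ψ) (N : ModuleCat.{u} R) :
    h.cornerFunctor.obj ((ModuleCat.restrictScalars φ).obj N) ≅ N where
  hom := h.cornerAdj.counit.app N
  inv := h.restrictAdj.unit.app N

lemma finite_cornerObj (h : IsRingFactor φ ψ) (M : ModuleCat.{u} T) [Module.Finite T M] :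
    Module.Finite R (h.cornerFunctor.obj M) := by
  have : RingHomSurjective φ := ⟨fun r => ⟨ψ r, h.map_map r⟩⟩
  let f : M →ₛₗ[φ] h.cornerObj M :=
    { toFun := fun m => (⟨ψ 1 • m, h.map_one_smul_mem m⟩ : h.corner M)
      map_add' := fun x y => Subtype.ext (smul_add _ _ _)
      map_smul' := fun t x => Subtype.ext (by
        change ψ 1 • t • x = ψ (φ t) • ψ 1 • x
        rw [← mul_smul, ← mul_smul, ← map_mul, mul_one, h.map_one_mul]) }
  exact Module.Finite.of_surjective f fun m => ⟨(m : h.corner M).1, Subtype.ext (m : h.corner M).2⟩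

lemma finite_restrictScalars (h : IsRingFactor φ ψ) (N : ModuleCat.{u} R) [Module.Finite R N] :
    Module.Finite T ((ModuleCat.restrictScalars φ).obj N) := by
  obtain ⟨s, hs⟩ := (Module.finite_def.1 ‹Module.Finite R N›)
  refine Module.finite_def.2 ⟨s, eq_top_iff.2 fun n _ => ?_⟩
  change N at n
  have hn : n ∈ Submodule.span R (s : Set N) := hs ▸ Submodule.mem_top
  induction hn using Submodule.span_induction with
  | mem x hx => exact Submodule.subset_span hx
  | zero => exact Submodule.zero_mem _
  | add x y _ _ hx hy => exact Submodule.add_mem _ (hx trivial) (hy trivial)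
  | smul r x _ hx =>
    have : (r • x : N) = (ψ r • (show (ModuleCat.restrictScalars φ).obj N from x) :
        (ModuleCat.restrictScalars φ).obj N) := by
      change r • x = φ (ψ r) • x
      rw [h.map_map]
    exact this ▸ Submodule.smul_mem _ (ψ r) (hx trivial)

lemma qgldim_le (h : IsRingFactor φ ψ) : qgldim R ≤ qgldim T := by
  refine sSup_le ?_
  rintro _ ⟨N, hN, rfl⟩
  exact (qpd_le_of_iso (h.cornerRestrictIso N)).trans <| (qpd_map_le h.cornerFunctor _).trans <|
    le_sSup ⟨_, h.finite_restrictScalars N, rfl⟩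

lemma qpd_restrict_corner_le (h : IsRingFactor φ ψ) (M : ModuleCat.{u} T) [Module.Finite T M] :
    qpd ((ModuleCat.restrictScalars φ).obj (h.cornerFunctor.obj M)) ≤ qgldim R := by
  have := h.restrictScalars_preservesHomology
  have := h.restrictScalars_preservesProjectiveObjects
  exact (qpd_map_le (ModuleCat.restrictScalars φ) _).trans
    (le_sSup ⟨_, h.finite_cornerObj M, rfl⟩)

/-- A module over a ring with two complementary factors is the direct sum of the parts
supported on each of them. -/
noncomputable def biprodIso {S : Type u} [Ring S] {φ' : T →+* S} {ψ' : S →ₙ+* T}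
    (h : IsRingFactor φ ψ) (h' : IsRingFactor φ' ψ') (h₁ : ψ 1 + ψ' 1 = 1)
    (M : ModuleCat.{u} T) :
    (ModuleCat.restrictScalars φ).obj (h.cornerFunctor.obj M) ⊞
      (ModuleCat.restrictScalars φ').obj (h'.cornerFunctor.obj M) ≅ M :=
  have h_comp {R S : Type u} [Ring R] [Ring S] {φ : T →+* R} {ψ : R →ₙ+* T}
      {φ' : T →+* S} {ψ' : S →ₙ+* T} (h : IsRingFactor φ ψ) (h' : IsRingFactor φ' ψ')
      (h₁ : ψ 1 + ψ' 1 = 1) : h.restrictAdj.counit.app M ≫ h'.cornerAdj.unit.app M = 0 := by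
    ext m
    refine Subtype.ext ?_
    change ψ' 1 • (m : h.corner M).1 = 0
    have : ψ' 1 * ψ 1 = 0 := by
      rw [eq_sub_of_add_eq' h₁, sub_mul, one_mul, ← map_mul, one_mul, sub_self]
    rw [← (show ψ 1 • (m : h.corner M).1 = _ from (m : h.corner M).2), ← mul_smul, this, zero_smul]
  have h_id {R : Type u} [Ring R] {φ : T →+* R} {ψ : R →ₙ+* T} (h : IsRingFactor φ ψ) :
      h.restrictAdj.counit.app M ≫ h.cornerAdj.unit.app M = 𝟙 _ := by
    ext m
    exact Subtype.ext (m : h.corner M).2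
  { hom := biprod.desc (h.restrictAdj.counit.app M) (h'.restrictAdj.counit.app M)
    inv := biprod.lift (h.cornerAdj.unit.app M) (h'.cornerAdj.unit.app M)
    hom_inv_id := by
      refine biprod.hom_ext' _ _ (biprod.hom_ext _ _ ?_ ?_) (biprod.hom_ext _ _ ?_ ?_)
      · simpa using h_id h
      · simpa using h_comp h h' h₁
      · simpa using h_comp h' h ((add_comm _ _).trans h₁)
      · simpa using h_id h'
    inv_hom_id := by
      rw [biprod.lift_desc]
      ext m
      change ψ 1 • m + ψ' 1 • m = m
      rw [← add_smul, h₁, one_smul] }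

end IsRingFactor

lemma isRingFactor_fst (R S : Type u) [Ring R] [Ring S] :
    IsRingFactor (RingHom.fst R S) ((NonUnitalRingHom.id R).prod 0) where
  map_map _ := rfl
  mul_map_one t := by ext <;> simp
  map_one_mul t := by ext <;> simp

lemma isRingFactor_snd (R S : Type u) [Ring R] [Ring S] :
    IsRingFactor (RingHom.snd R S) (NonUnitalRingHom.prod 0 (NonUnitalRingHom.id S)) where
  map_map _ := rfl
  mul_map_one t := by ext <;> simp
  map_one_mul t := by ext <;> simp

end QPD

open QPD in
/-- `qgldim (R × S) = max (qgldim R) (qgldim S)` for left Noetherian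
rings `R` and `S`. -/
theorem qgldim_prod {R S : Type u} [Ring R] [Ring S]
    [IsNoetherianRing R] [IsNoetherianRing S] :
    qgldim (R × S) = max (qgldim R) (qgldim S) := by
  have h := isRingFactor_fst R S
  have h' := isRingFactor_snd R S
  refine le_antisymm (sSup_le ?_) (max_le h.qgldim_le h'.qgldim_le)
  rintro _ ⟨M, hM, rfl⟩
  exact (qpd_le_of_iso (h.biprodIso h' (by ext <;> simp) M)).trans <|
    (qpd_biprod_le _ _).trans <|
      max_le_max (h.qpd_restrict_corner_le M) (h'.qpd_restrict_corner_le M)
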